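/- arXiv:1912.02440 — 2 statements merged into one kernel-verified Lean document; each statement's English description precedes it below -/
import Mathlib

section
/- For every integer m ≥ 1: ad^r(K)((E K^{-1})^m) = q^{-2m}(E K^{-1})^m, ad^r(E)((E K^{-1})^m) = 0, ad^r(F^k)((E K^{-1})^m) ≠ 0 for every 0 ≤ k ≤ 2m, and ad^r(F^k)((E K^{-1})^m) = 0 for every k ≥ 2m + 1; consequently the ℂ(q)-linear span of ad^r(U_q)((E K^{-1})^m) has dimension 2m + 1. -/
noncomputable section

open scoped TensorProduct

abbrev Kq : Type := RatFunc ℂ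

/-- The indeterminate `q`. -/
noncomputable def qv : Kq := RatFunc.X

/-- Generators `E`, `F`, `K`, `K⁻¹` of the quantum group `U_q(sl(2))`. -/
inductive UGen : Type
  | E | F | K | Kinv

/-- The defining relations of `U_q(sl(2))`. -/
inductive URel : FreeAlgebra Kq UGen → FreeAlgebra Kq UGen → Prop
  | KKinv : URel (FreeAlgebra.ι Kq UGen.K * FreeAlgebra.ι Kq UGen.Kinv) 1
  | KinvK : URel (FreeAlgebra.ι Kq UGen.Kinv * FreeAlgebra.ι Kq UGen.K) 1
  | KE : URel (FreeAlgebra.ι Kq UGen.K * FreeAlgebra.ι Kq UGen.E * FreeAlgebra.ι Kq UGen.Kinv)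
      ((qv ^ 2) • FreeAlgebra.ι Kq UGen.E)
  | KF : URel (FreeAlgebra.ι Kq UGen.K * FreeAlgebra.ι Kq UGen.F * FreeAlgebra.ι Kq UGen.Kinv)
      ((qv⁻¹ ^ 2) • FreeAlgebra.ι Kq UGen.F)
  | EF : URel (FreeAlgebra.ι Kq UGen.E * FreeAlgebra.ι Kq UGen.F
        - FreeAlgebra.ι Kq UGen.F * FreeAlgebra.ι Kq UGen.E)
      (((qv - qv⁻¹)⁻¹) • (FreeAlgebra.ι Kq UGen.K - FreeAlgebra.ι Kq UGen.Kinv))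

/-- The quantum group `U_q = U_q(sl(2))`, presented by generators and relations. -/
abbrev Uq : Type := RingQuot URel

noncomputable def Eel : Uq := RingQuot.mkAlgHom Kq URel (FreeAlgebra.ι Kq UGen.E)
noncomputable def Fel : Uq := RingQuot.mkAlgHom Kq URel (FreeAlgebra.ι Kq UGen.F)
noncomputable def Kel : Uq := RingQuot.mkAlgHom Kq URel (FreeAlgebra.ι Kq UGen.K)
noncomputable def Kinvel : Uq := RingQuot.mkAlgHom Kq URel (FreeAlgebra.ι Kq UGen.Kinv)

/-- The bilinear map `(u, v) ↦ S(u) * x * v` underlying the right adjoint action. -/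
noncomputable def adrBil (Smap : Uq →ₗ[Kq] Uq) (x : Uq) : Uq →ₗ[Kq] Uq →ₗ[Kq] Uq :=
  LinearMap.mk₂ Kq (fun u v => Smap u * x * v)
    (fun u u' v => by simp only [map_add, add_mul])
    (fun cc u v => by simp only [map_smul, smul_mul_assoc])
    (fun u v v' => by simp only [mul_add])
    (fun cc u v => by simp only [mul_smul_comm])

/-- The right adjoint action `ad^r(y)(x) = Σ S(y₍₁₎) x y₍₂₎` (Sweedler notation),
defined via the coproduct `Δ` and the antipode `S`. -/
noncomputable def adr (Smap : Uq →ₗ[Kq] Uq) (Δmap : Uq →ₐ[Kq] Uq ⊗[Kq] Uq)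
    (y x : Uq) : Uq :=
  TensorProduct.lift (adrBil Smap x) (Δmap y)

section HighestWeight

variable {k V : Type*} [Field k] [AddCommGroup V] [Module k V]

/-- The lowering operator shifts the weight of each `f ^ n x` by `q ^ 2`. -/
lemma weight_pow_apply {q : k} (hq : q ≠ 0) {f κ : Module.End k V} {x : V} {a : ℤ}
    (hκf : ∀ v, κ (f v) = q ^ 2 • f (κ v)) (hx : κ x = q ^ a • x) (n : ℕ) :
    κ ((f ^ n) x) = q ^ (a + 2 * n) • (f ^ n) x := by
  induction n with
  | zero => simpa using hx
  | succ n ih =>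
    rw [pow_succ', Module.End.mul_apply, hκf, ih, map_smul, smul_smul]
    congr 1
    rw [← zpow_natCast, ← zpow_add₀ hq]
    congr 1
    push_cast
    ring

/-- The scalar by which the raising operator takes `f ^ (n + 1) x` to `f ^ n x`, when `x` is a
highest weight vector of weight `q ^ (-2 m)` for the right adjoint action. -/
def raisingCoeff (q : k) (m : ℕ) (n : ℤ) : k :=
  (q ^ (2 * (m : ℤ) + 1) + q ^ (-(2 * (m : ℤ) + 1))
    - (q ^ (2 * m - 2 * n + 1) + q ^ (-(2 * m - 2 * n + 1)))) * ((q - q⁻¹)⁻¹ * (q - q⁻¹)⁻¹)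

lemma sub_inv_ne_zero_of_generic {q : k} (hq : q ≠ 0) (hgen : ∀ a : ℤ, q ^ a = 1 → a = 0) :
    q - q⁻¹ ≠ 0 := by
  intro h
  have := hgen 2 (by
    rw [sub_eq_zero] at h
    rw [show (2 : ℤ) = 1 + 1 by norm_num, zpow_add₀ hq, zpow_one]
    nth_rewrite 1 [h]
    exact inv_mul_cancel₀ hq)
  omega

lemma raisingCoeff_ne_zero {q : k} (hq : q ≠ 0) (hgen : ∀ a : ℤ, q ^ a = 1 → a = 0)
    {m n : ℕ} (hn : 1 ≤ n) (hnm : n ≤ 2 * m) : raisingCoeff q m n ≠ 0 := by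
  have key : ∀ a b : ℤ, a ≠ b → a ≠ -b → q ^ a + q ^ (-a) - (q ^ b + q ^ (-b)) ≠ 0 := by
    intro a b h1 h2 h
    have ha := zpow_ne_zero a hq
    have hb := zpow_ne_zero b hq
    have h3 : (q ^ a - q ^ b) * (q ^ a * q ^ b - 1) = 0 := by
      rw [zpow_neg, zpow_neg] at h
      field_simp at h
      linear_combination h
    rcases mul_eq_zero.1 h3 with h4 | h4
    · have := hgen (a - b) (by rw [zpow_sub₀ hq, sub_eq_zero.1 h4, div_self hb])
      omega
    · have := hgen (a + b) (by rw [zpow_add₀ hq, sub_eq_zero.1 h4])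
      omega
  have hs := inv_ne_zero (sub_inv_ne_zero_of_generic hq hgen)
  exact mul_ne_zero (key _ _ (by omega) (by omega)) (mul_ne_zero hs hs)

lemma raisingCoeff_succ {q : k} (hq : q ≠ 0) (hs : q - q⁻¹ ≠ 0) (m : ℕ) (n : ℤ) :
    raisingCoeff q m (n + 1) = raisingCoeff q m n
      - (q - q⁻¹)⁻¹ * (q ^ (-(2 * m) + 2 * n) - q ^ (-(-(2 * (m : ℤ)) + 2 * n))) := by
  have e1 : (2 * (m : ℤ) - 2 * (n + 1) + 1) = -(-(2 * (m : ℤ)) + 2 * n) + -1 := by ring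
  have e2 : (2 * (m : ℤ) - 2 * n + 1) = -(-(2 * (m : ℤ)) + 2 * n) + 1 := by ring
  unfold raisingCoeff
  rw [e1, e2]
  generalize (-(2 * (m : ℤ)) + 2 * n) = a
  generalize q ^ (2 * (m : ℤ) + 1) + q ^ (-(2 * (m : ℤ) + 1)) = s
  have h1 : q ^ (-a + -1) = (q ^ a)⁻¹ * q⁻¹ := by
    rw [zpow_add₀ hq, zpow_neg, zpow_neg_one]
  have h2 : q ^ (-a + 1) = (q ^ a)⁻¹ * q := by
    rw [zpow_add₀ hq, zpow_neg, zpow_one]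
  rw [zpow_neg q (-a + -1), zpow_neg q (-a + 1), h1, h2, zpow_neg]
  have ha := zpow_ne_zero a hq
  generalize q ^ a = t at *
  generalize hu : q - q⁻¹ = u at *
  have hv : u⁻¹ = u⁻¹ * u⁻¹ * (q - q⁻¹) := by rw [hu]; field_simp
  rw [mul_inv, mul_inv, inv_inv, inv_inv]
  linear_combination (t - t⁻¹) * hv

lemma raising_pow_apply {q : k} (hq : q ≠ 0) (hs : q - q⁻¹ ≠ 0) {e f κ κ' : Module.End k V}
    {x : V} {m : ℕ}
    (hκf : ∀ v, κ (f v) = q ^ 2 • f (κ v)) (hκ' : ∀ v, κ' (κ v) = v)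
    (hef : ∀ v, e (f v) = f (e v) - (q - q⁻¹)⁻¹ • (κ v - κ' v))
    (hx : κ x = q ^ (-(2 * m : ℤ)) • x) (hex : e x = 0) (n : ℕ) :
    e ((f ^ (n + 1)) x) = raisingCoeff q m (n + 1) • (f ^ n) x := by
  have hw (n : ℕ) := weight_pow_apply hq hκf hx n
  have hw' (n : ℕ) : κ' ((f ^ n) x) = q ^ (-(-(2 * m : ℤ) + 2 * n)) • (f ^ n) x := by
    have h := congrArg (fun v => q ^ (-(-(2 * m : ℤ) + 2 * n)) • κ' v) (hw n)
    simp only [map_smul, smul_smul, ← zpow_add₀ hq, hκ'] at h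
    simpa using h.symm
  have step (n : ℕ) : e ((f ^ (n + 1)) x) = f (e ((f ^ n) x)) -
      ((q - q⁻¹)⁻¹ * (q ^ (-(2 * m) + 2 * (n : ℤ)) - q ^ (-(-(2 * (m : ℤ)) + 2 * (n : ℤ)))))
        • (f ^ n) x := by
    rw [pow_succ', Module.End.mul_apply, hef, hw, hw', ← sub_smul, smul_smul]
  induction n with
  | zero =>
    rw [step, raisingCoeff_succ hq hs]
    simp [raisingCoeff, hex]
  | succ n ih =>
    rw [step, ih, map_smul, ← Module.End.mul_apply, ← pow_succ', ← sub_smul]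
    push_cast
    rw [raisingCoeff_succ hq hs m (n + 1)]

lemma add_neg_smul_add_smul (c : k) (u v w : V) :
    u + (-c) • v + c • w = u - c • (v - w) := by
  module

lemma pow_apply_ne_zero_of_highest {q : k} (hq : q ≠ 0) (hgen : ∀ a : ℤ, q ^ a = 1 → a = 0)
    {e f : Module.End k V} {x : V} {m : ℕ} (hx0 : x ≠ 0)
    (he : ∀ n : ℕ, e ((f ^ (n + 1)) x) = raisingCoeff q m (n + 1) • (f ^ n) x)
    {n : ℕ} (hn : n ≤ 2 * m) : (f ^ n) x ≠ 0 := by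
  induction n with
  | zero => simpa using hx0
  | succ n ih =>
    intro h
    have h1 := he n
    rw [h, map_zero] at h1
    have h2 := raisingCoeff_ne_zero hq hgen (m := m) (n := n + 1) (by omega) hn
    push_cast at h2
    exact smul_ne_zero h2 (ih (by omega)) h1.symm

/-- The vectors `f ^ n x`, `n < N`, are linearly independent as soon as they do not vanish. -/
lemma linearIndependent_pow_apply {q : k} (hq : q ≠ 0) (hgen : ∀ a : ℤ, q ^ a = 1 → a = 0)
    {f κ : Module.End k V} {x : V} {a : ℤ} {N : ℕ}
    (hκ : ∀ n : ℕ, κ ((f ^ n) x) = q ^ (a + 2 * n) • (f ^ n) x)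
    (h0 : ∀ n < N, (f ^ n) x ≠ 0) :
    LinearIndependent k (fun i : Fin N => (f ^ (i : ℕ)) x) := by
  refine Module.End.eigenvectors_linearIndependent' κ (fun i : Fin N => q ^ (a + 2 * (i : ℤ)))
    ?_ _ fun i => ⟨Module.End.mem_eigenspace_iff.2 (hκ i), h0 i i.2⟩
  intro i j hij
  have := hgen ((a + 2 * (i : ℤ)) - (a + 2 * (j : ℤ))) (by
    rw [zpow_sub₀ hq]
    exact (div_eq_one_iff_eq (zpow_ne_zero _ hq)).2 hij)
  exact Fin.ext (by omega)

end HighestWeight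

section TwistedDerivation

variable {k A : Type*} [Field k] [Ring A] [Algebra k A]

/-- A version of the Leibniz bound for nilpotency under a twisted derivation. -/
lemma twisted_pow_mul_eq_zero {D σ : Module.End k A} {c : k}
    (hD : ∀ x y, D (x * y) = σ x * D y + D x * y) (hσ : ∀ x, D (σ x) = c • σ (D x)) :
    ∀ (n a b : ℕ) (x y : A), n + 1 = a + b → (D ^ a) x = 0 → (D ^ b) y = 0 →
      (D ^ n) (x * y) = 0 := by
  have hσ' (a : ℕ) : ∀ x, (D ^ a) x = 0 → (D ^ a) (σ x) = 0 := by
    have h : ∀ x, (D ^ a) (σ x) = c ^ a • σ ((D ^ a) x) := by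
      induction a with
      | zero => simp
      | succ a ih =>
        intro x
        rw [pow_succ', Module.End.mul_apply, ih, map_smul, hσ, smul_smul, pow_succ,
          Module.End.mul_apply]
    intro x hx
    rw [h, hx, map_zero, smul_zero]
  intro n
  induction n with
  | zero =>
    intro a b x y hab hx hy
    rcases a with _ | a
    · have : x = 0 := by simpa using hx
      simp [this]
    · obtain rfl : b = 0 := by omega
      have : y = 0 := by simpa using hy
      simp [this]
  | succ n ih =>
    intro a b x y hab hx hy
    rcases a with _ | a
    · have : x = 0 := by simpa using hx
      simp [this]
    rcases b with _ | b
    · have : y = 0 := by simpa using hy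
      simp [this]
    rw [pow_succ, Module.End.mul_apply, hD, map_add,
      ih (a + 1) b _ _ (by omega) (hσ' _ _ hx) (by rwa [pow_succ, Module.End.mul_apply] at hy),
      ih a (b + 1) _ _ (by omega) (by rwa [pow_succ, Module.End.mul_apply] at hx) hy, add_zero]

lemma twisted_pow_pow_eq_zero {D σ : Module.End k A} {c : k}
    (hD : ∀ x y, D (x * y) = σ x * D y + D x * y) (hσ : ∀ x, D (σ x) = c • σ (D x))
    (hone : D 1 = 0) {x : A} {d : ℕ} (hx : (D ^ (d + 1)) x = 0) (m : ℕ) :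
    (D ^ (d * m + 1)) (x ^ m) = 0 := by
  induction m with
  | zero => simpa using hone
  | succ m ih =>
    rw [pow_succ x m]
    exact twisted_pow_mul_eq_zero hD hσ (d * (m + 1) + 1) (d * m + 1) (d + 1) _ _ (by ring) ih hx

/-- The operator `y ↦ K [y, F]`. -/
def twistedCommutator (k : Type*) {A : Type*} [Field k] [Ring A] [Algebra k A] (K F : A) :
    Module.End k A :=
  LinearMap.mulLeft k K ∘ₗ (LinearMap.mulRight k F - LinearMap.mulLeft k F)

lemma twistedCommutator_apply (K F y : A) :
    twistedCommutator k K F y = K * (y * F - F * y) := rfl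

lemma mul_mul_add_neg_mul_eq_twistedCommutator (K F y : A) :
    K * y * F + -(K * F) * y = twistedCommutator k K F y := by
  rw [twistedCommutator_apply, mul_sub, neg_mul, ← sub_eq_add_neg, mul_assoc, mul_assoc]

lemma twistedCommutator_one (K F : A) : twistedCommutator k K F 1 = 0 := by
  rw [twistedCommutator_apply, one_mul, mul_one, sub_self, mul_zero]

lemma neg_mul_pow_mul_add_pow_mul {E K K' : A} (hK'K : K' * K = 1) (m : ℕ) :
    -(E * K') * (E * K') ^ m * K + (E * K') ^ m * E = 0 := by
  have h : (E * K') ^ m * E = E * K' * (E * K') ^ m * K := by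
    rw [← pow_succ', pow_succ, mul_assoc, mul_assoc, hK'K, mul_one]
  rw [h, neg_mul, neg_mul, neg_add_cancel]

lemma mul_eq_add_smul_add_smul_of_commutator {E F K K' : A} {c : k}
    (h : E * F - F * E = c • (K - K')) : F * E = E * F + (-c) • K + c • K' := by
  rw [sub_eq_iff_eq_add] at h
  rw [h]
  module

lemma twistedCommutator_mul {K K' F : A} (hK'K : K' * K = 1) (x y : A) :
    twistedCommutator k K F (x * y) =
      (LinearMap.mulLeft k K ∘ₗ LinearMap.mulRight k K') x * twistedCommutator k K F y
        + twistedCommutator k K F x * y := by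
  have h : (K * (x * K')) * (K * (y * F - F * y)) = K * x * (y * F - F * y) := by
    calc _ = K * x * (K' * K) * (y * F - F * y) := by noncomm_ring
      _ = _ := by rw [hK'K, mul_one]
  simp only [twistedCommutator_apply, LinearMap.comp_apply, LinearMap.mulLeft_apply,
    LinearMap.mulRight_apply]
  rw [h]
  noncomm_ring

lemma twistedCommutator_conj {K K' F : A} {q : k} (hq : q ≠ 0)
    (hK'K : K' * K = 1) (hKF : K * F * K' = (q⁻¹ ^ 2) • F) (x : A) :
    twistedCommutator k K F ((LinearMap.mulLeft k K ∘ₗ LinearMap.mulRight k K') x) =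
      q ^ 2 • (LinearMap.mulLeft k K ∘ₗ LinearMap.mulRight k K') (twistedCommutator k K F x) := by
  simp only [twistedCommutator_apply, LinearMap.comp_apply, LinearMap.mulLeft_apply,
    LinearMap.mulRight_apply]
  have h : F = q ^ 2 • (K * F * K') := by
    rw [hKF, smul_smul, inv_pow, mul_inv_cancel₀ (pow_ne_zero 2 hq), one_smul]
  have h1 : K * (x * K') * F = q ^ 2 • (K * (x * F) * K') := by
    conv_lhs => rw [h]
    rw [mul_smul_comm]
    congr 1
    calc _ = K * x * (K' * K) * F * K' := by noncomm_ring
      _ = _ := by rw [hK'K]; noncomm_ring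
  have h2 : F * (K * (x * K')) = q ^ 2 • (K * (F * x) * K') := by
    conv_lhs => rw [h]
    rw [smul_mul_assoc]
    congr 1
    calc _ = K * F * (K' * K) * x * K' := by noncomm_ring
      _ = _ := by rw [hK'K]; noncomm_ring
  rw [h1, h2, ← smul_sub, mul_smul_comm]
  congr 1
  noncomm_ring

lemma mul_eq_smul_of_conj {F K K' : A} {q : k} (hq : q ≠ 0) (hK'K : K' * K = 1)
    (hKF : K * F * K' = (q⁻¹ ^ 2) • F) : F * K = q ^ 2 • (K * F) := by
  have h : K * F = q⁻¹ ^ 2 • (F * K) := by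
    calc K * F = K * F * K' * K := by rw [mul_assoc, hK'K, mul_one]
      _ = _ := by rw [hKF, smul_mul_assoc]
  rw [h, smul_smul, inv_pow, mul_inv_cancel₀ (pow_ne_zero 2 hq), one_smul]

lemma conj_inv_mul_of_conj {E K K' : A} {q : k} (hq : q ≠ 0) (hK'K : K' * K = 1)
    (hKE : K * E * K' = (q ^ 2) • E) : K' * (E * K') * K = q⁻¹ ^ 2 • (E * K') := by
  have h : E = q⁻¹ ^ 2 • (K * E * K') := by
    rw [hKE, smul_smul, ← mul_pow, inv_mul_cancel₀ hq, one_pow, one_smul]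
  calc K' * (E * K') * K = K' * E * (K' * K) := by noncomm_ring
    _ = K' * E := by rw [hK'K, mul_one]
    _ = q⁻¹ ^ 2 • (K' * K * E * K') := by
      conv_lhs => rw [h]
      rw [mul_smul_comm]
      simp only [mul_assoc]
    _ = _ := by rw [hK'K, one_mul]

lemma conj_pow_of_conj {K K' x : A} {c : k} (hK'K : K' * K = 1) (hKK' : K * K' = 1)
    (hx : K' * x * K = c • x) (m : ℕ) : K' * x ^ m * K = c ^ m • x ^ m := by
  induction m with
  | zero => simpa using hK'K
  | succ m ih =>
    calc K' * x ^ (m + 1) * K = K' * x ^ m * (K * K') * x * K := by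
          rw [hKK', mul_one, pow_succ]; noncomm_ring
      _ = (K' * x ^ m * K) * (K' * x * K) := by noncomm_ring
      _ = _ := by rw [ih, hx, smul_mul_smul_comm, pow_succ, pow_succ]

lemma twistedCommutator_pow_three {E F K K' : A} {q : k} (hq : q ≠ 0)
    (hKK' : K * K' = 1) (hK'K : K' * K = 1)
    (hKE : K * E * K' = (q ^ 2) • E) (hKF : K * F * K' = (q⁻¹ ^ 2) • F)
    (hEF : E * F - F * E = ((q - q⁻¹)⁻¹) • (K - K')) :
    (twistedCommutator k K F ^ 3) (E * K') = 0 := by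
  have hFK : F * K = q ^ 2 • (K * F) := mul_eq_smul_of_conj hq hK'K hKF
  set D := twistedCommutator k K F with hDdef
  have hDF : D F = 0 := by simp [hDdef, twistedCommutator_apply]
  have hDK : D K = (1 - q ^ 2) • (K * K * F) := by
    rw [hDdef, twistedCommutator_apply, hFK, sub_smul, one_smul, mul_sub, mul_smul_comm, mul_assoc]
  have hDK' : D K' = (1 - q⁻¹ ^ 2) • F := by
    rw [hDdef, twistedCommutator_apply, mul_sub, ← mul_assoc, ← mul_assoc, hKK', hKF, one_mul,
      sub_smul, one_smul]
  have hDEF : D (E * F) = (q - q⁻¹)⁻¹ • (K * K * F - F) := by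
    have : D (E * F) = K * (E * F - F * E) * F := by
      rw [hDdef, twistedCommutator_apply]
      noncomm_ring
    rw [this, hEF, mul_smul_comm, smul_mul_assoc, mul_sub, sub_mul, hKK', one_mul]
  have hDe : D (E * K') = (q ^ 2 - 1) • (E * F) + (q - q⁻¹)⁻¹ • (K - K') := by
    have h1 : K * (E * K' * F) = q ^ 2 • (E * F) := by
      rw [← mul_assoc, ← mul_assoc, hKE, smul_mul_assoc]
    have h2 : K * (F * (E * K')) = F * E := by
      calc _ = K * F * K' * (K * E * K') + K * F * (1 - K' * K) * E * K' := by noncomm_ring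
        _ = _ := by
          rw [hK'K, hKF, hKE, smul_mul_smul_comm, ← mul_pow, inv_mul_cancel₀ hq]
          simp
    rw [hDdef, twistedCommutator_apply, mul_sub, h1, h2, ← hEF, sub_smul, one_smul]
    abel
  have hD2 : ∃ c : k, D (D (E * K')) = c • F := by
    refine ⟨(q - q⁻¹)⁻¹ * (-(q ^ 2 - 1) - (1 - q⁻¹ ^ 2)), ?_⟩
    rw [hDe, map_add, map_smul, map_smul, map_sub, hDEF, hDK, hDK']
    module
  obtain ⟨c, hc⟩ := hD2
  rw [pow_succ', pow_succ', pow_one, Module.End.mul_apply, Module.End.mul_apply, hc, map_smul,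
    hDF, smul_zero]

end TwistedDerivation

section Generators

lemma Kel_mul_Kinvel : Kel * Kinvel = 1 := by
  have h := RingQuot.mkAlgHom_rel Kq URel.KKinv
  rwa [map_mul, map_one] at h

lemma Kinvel_mul_Kel : Kinvel * Kel = 1 := by
  have h := RingQuot.mkAlgHom_rel Kq URel.KinvK
  rwa [map_mul, map_one] at h

lemma Kel_mul_Eel_mul_Kinvel : Kel * Eel * Kinvel = (qv ^ 2) • Eel := by
  have h := RingQuot.mkAlgHom_rel Kq URel.KE
  rwa [map_mul, map_mul, map_smul] at h

lemma Kel_mul_Fel_mul_Kinvel : Kel * Fel * Kinvel = (qv⁻¹ ^ 2) • Fel := by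
  have h := RingQuot.mkAlgHom_rel Kq URel.KF
  rwa [map_mul, map_mul, map_smul] at h

lemma Eel_mul_Fel_sub : Eel * Fel - Fel * Eel = ((qv - qv⁻¹)⁻¹) • (Kel - Kinvel) := by
  have h := RingQuot.mkAlgHom_rel Kq URel.EF
  rwa [map_sub, map_mul, map_mul, map_smul, map_sub] at h

lemma qv_ne_zero : qv ≠ 0 := RatFunc.X_ne_zero

lemma qv_zpow_eq_one (a : ℤ) (h : qv ^ a = 1) : a = 0 := by
  have hnat : ∀ n : ℕ, qv ^ n = 1 → n = 0 := by
    intro n hn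
    have h1 : algebraMap (Polynomial ℂ) (RatFunc ℂ) (Polynomial.X ^ n)
        = algebraMap (Polynomial ℂ) (RatFunc ℂ) 1 := by
      rw [map_pow, map_one, RatFunc.algebraMap_X]
      exact hn
    have h2 := congrArg Polynomial.natDegree (RatFunc.algebraMap_injective ℂ h1)
    simpa using h2
  rcases Int.eq_nat_or_neg a with ⟨n, rfl | rfl⟩
  · rw [zpow_natCast] at h
    simp [hnat n h]
  · rw [zpow_neg, zpow_natCast, inv_eq_one] at h
    simp [hnat n h]

/-- A property closed under the algebra operations that holds on the generators holds on `U_q`. -/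
lemma Uq_induction {P : Uq → Prop} (hE : P Eel) (hF : P Fel) (hK : P Kel) (hK' : P Kinvel)
    (halg : ∀ c : Kq, P (algebraMap Kq Uq c)) (hadd : ∀ u v, P u → P v → P (u + v))
    (hmul : ∀ u v, P u → P v → P (u * v)) (y : Uq) : P y := by
  obtain ⟨z, rfl⟩ := RingQuot.mkAlgHom_surjective Kq URel y
  induction z using FreeAlgebra.induction with
  | grade0 c => rw [AlgHom.commutes]; exact halg c
  | grade1 g =>
    cases g
    exacts [hE, hF, hK, hK']
  | mul a b ha hb => rw [map_mul]; exact hmul _ _ ha hb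
  | add a b ha hb => rw [map_add]; exact hadd _ _ ha hb

end Generators

section Representation

/-- The action of the generators on functions `ℤ → ℂ(q)` in which `E` is the shift. -/
def shiftRepGen : UGen → Module.End Kq (ℤ → Kq)
  | .E => LinearMap.funLeft Kq Kq (fun n => n - 1)
  | .F => LinearMap.pi fun n =>
      (-(qv ^ (2 * n + 1) + qv ^ (-(2 * n + 1))) * ((qv - qv⁻¹)⁻¹ * (qv - qv⁻¹)⁻¹)) •
        LinearMap.proj (n + 1)
  | .K => LinearMap.pi fun n => (qv ^ (2 * n)) • LinearMap.proj n
  | .Kinv => LinearMap.pi fun n => (qv ^ (-(2 * n))) • LinearMap.proj n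

lemma shiftRepGen_E (φ : ℤ → Kq) (n : ℤ) : shiftRepGen .E φ n = φ (n - 1) := rfl

lemma shiftRepGen_F (φ : ℤ → Kq) (n : ℤ) : shiftRepGen .F φ n =
    (-(qv ^ (2 * n + 1) + qv ^ (-(2 * n + 1))) * ((qv - qv⁻¹)⁻¹ * (qv - qv⁻¹)⁻¹)) *
      φ (n + 1) := rfl

lemma shiftRepGen_K (φ : ℤ → Kq) (n : ℤ) : shiftRepGen .K φ n = qv ^ (2 * n) * φ n := rfl

lemma shiftRepGen_Kinv (φ : ℤ → Kq) (n : ℤ) :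
    shiftRepGen .Kinv φ n = qv ^ (-(2 * n)) * φ n := rfl

lemma shiftRepGen_rel ⦃a b : FreeAlgebra Kq UGen⦄ (h : URel a b) :
    FreeAlgebra.lift Kq shiftRepGen a = FreeAlgebra.lift Kq shiftRepGen b := by
  have hq := qv_ne_zero
  have hs := sub_inv_ne_zero_of_generic hq qv_zpow_eq_one
  cases h with
  | KKinv =>
    ext1 φ; funext n
    simp only [map_mul, map_one, FreeAlgebra.lift_ι_apply, Module.End.mul_apply,
      Module.End.one_apply, shiftRepGen_K, shiftRepGen_Kinv]
    rw [← mul_assoc, ← zpow_add₀ hq, add_neg_cancel, zpow_zero, one_mul]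
  | KinvK =>
    ext1 φ; funext n
    simp only [map_mul, map_one, FreeAlgebra.lift_ι_apply, Module.End.mul_apply,
      Module.End.one_apply, shiftRepGen_K, shiftRepGen_Kinv]
    rw [← mul_assoc, ← zpow_add₀ hq, neg_add_cancel, zpow_zero, one_mul]
  | KE =>
    ext1 φ; funext n
    simp only [map_mul, map_smul, FreeAlgebra.lift_ι_apply, Module.End.mul_apply,
      LinearMap.smul_apply, Pi.smul_apply, smul_eq_mul, shiftRepGen_K, shiftRepGen_Kinv,
      shiftRepGen_E]
    rw [← mul_assoc, ← zpow_add₀ hq, ← zpow_natCast]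
    congr 2
    push_cast
    ring
  | KF =>
    ext1 φ; funext n
    simp only [map_mul, map_smul, FreeAlgebra.lift_ι_apply, Module.End.mul_apply,
      LinearMap.smul_apply, Pi.smul_apply, smul_eq_mul, shiftRepGen_K, shiftRepGen_Kinv,
      shiftRepGen_F]
    have h : qv ^ (2 * n) * qv ^ (-(2 * (n + 1))) = qv⁻¹ ^ 2 := by
      rw [← zpow_add₀ hq, inv_pow, ← zpow_natCast, ← zpow_neg]
      congr 1
      push_cast
      ring
    rw [← h]
    ring
  | EF =>
    ext1 φ; funext n
    simp only [map_mul, map_smul, map_sub, FreeAlgebra.lift_ι_apply, Module.End.mul_apply,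
      LinearMap.smul_apply, LinearMap.sub_apply, Pi.smul_apply, Pi.sub_apply, smul_eq_mul,
      shiftRepGen_K, shiftRepGen_Kinv, shiftRepGen_E, shiftRepGen_F]
    rw [sub_add_cancel, add_sub_cancel_right]
    have h1 : qv ^ (2 * n + 1) = qv ^ (2 * n) * qv := by rw [zpow_add₀ hq, zpow_one]
    have h2 : qv ^ (2 * (n - 1) + 1) = qv ^ (2 * n) * qv⁻¹ := by
      rw [show 2 * (n - 1) + 1 = 2 * n + -1 by ring, zpow_add₀ hq, zpow_neg_one]
    rw [zpow_neg, zpow_neg, zpow_neg, h1, h2, mul_inv, mul_inv, inv_inv]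
    generalize qv ^ (2 * n) = t
    generalize hu : qv - qv⁻¹ = u at *
    have hv : u⁻¹ = u⁻¹ * u⁻¹ * (qv - qv⁻¹) := by rw [hu]; field_simp
    linear_combination -(t - t⁻¹) * φ n * hv

/-- The representation of `U_q` on functions `ℤ → ℂ(q)` in which `E` is the shift. -/
def shiftRep : Uq →ₐ[Kq] Module.End Kq (ℤ → Kq) :=
  RingQuot.liftAlgHom Kq ⟨FreeAlgebra.lift Kq shiftRepGen, shiftRepGen_rel⟩

lemma Eel_mul_Kinvel_pow_ne_zero (m : ℕ) : (Eel * Kinvel) ^ m ≠ 0 := by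
  have hE : shiftRep Eel = shiftRepGen .E := by
    rw [shiftRep, Eel, RingQuot.liftAlgHom_mkAlgHom_apply, FreeAlgebra.lift_ι_apply]
  have hK : shiftRep Kinvel = shiftRepGen .Kinv := by
    rw [shiftRep, Kinvel, RingQuot.liftAlgHom_mkAlgHom_apply, FreeAlgebra.lift_ι_apply]
  have key : ∀ m : ℕ, ∀ n : ℤ, (shiftRep ((Eel * Kinvel) ^ m)) (fun _ => 1) n ≠ 0 := by
    intro m
    induction m with
    | zero => intro n; simp
    | succ m ih =>
      intro n
      rw [pow_succ', map_mul, map_mul, hE, hK, Module.End.mul_apply, Module.End.mul_apply,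
        shiftRepGen_E, shiftRepGen_Kinv]
      exact mul_ne_zero (zpow_ne_zero _ qv_ne_zero) (ih _)
  intro h
  apply key m 0
  rw [h, map_zero]
  rfl

end Representation

section AdjointAction

variable (Smap : Uq →ₗ[Kq] Uq) (Δmap : Uq →ₐ[Kq] Uq ⊗[Kq] Uq)

/-- The right adjoint action of a fixed element, as a linear endomorphism. -/
def adrEnd (y : Uq) : Module.End Kq Uq where
  toFun x := adr Smap Δmap y x
  map_add' x x' := by
    simp only [adr]
    induction Δmap y using TensorProduct.induction_on with
    | zero => simp
    | tmul u v => simp [adrBil, mul_add, add_mul]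
    | add s t hs ht => simp only [map_add, hs, ht]; abel
  map_smul' c x := by
    simp only [adr, RingHom.id_apply]
    induction Δmap y using TensorProduct.induction_on with
    | zero => simp
    | tmul u v => simp [adrBil]
    | add s t hs ht => simp only [map_add, hs, ht, smul_add]

lemma adrEnd_apply (y x : Uq) : adrEnd Smap Δmap y x = adr Smap Δmap y x := rfl

lemma adrEnd_add (y z : Uq) :
    adrEnd Smap Δmap (y + z) = adrEnd Smap Δmap y + adrEnd Smap Δmap z := by
  ext x
  simp only [adrEnd_apply, LinearMap.add_apply, adr, map_add]

lemma adrEnd_smul (c : Kq) (y : Uq) :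
    adrEnd Smap Δmap (c • y) = c • adrEnd Smap Δmap y := by
  ext x
  simp only [adrEnd_apply, LinearMap.smul_apply, adr, map_smul]

variable {Smap}

lemma adrEnd_mul (hSmul : ∀ u v : Uq, Smap (u * v) = Smap v * Smap u) (y z : Uq) :
    adrEnd Smap Δmap (y * z) = adrEnd Smap Δmap z * adrEnd Smap Δmap y := by
  have key : ∀ (s t : Uq ⊗[Kq] Uq) (x : Uq), TensorProduct.lift (adrBil Smap x) (s * t)
      = TensorProduct.lift (adrBil Smap (TensorProduct.lift (adrBil Smap x) s)) t := by
    intro s t x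
    induction t using TensorProduct.induction_on with
    | zero => simp
    | add t t' ht ht' => simp only [mul_add, map_add, ht, ht']
    | tmul u v =>
      simp only [TensorProduct.lift.tmul, adrBil, LinearMap.mk₂_apply]
      induction s using TensorProduct.induction_on with
      | zero => simp
      | add s s' hs hs' => simp only [add_mul, mul_add, map_add, hs, hs']
      | tmul u' v' => simp [hSmul, mul_assoc]
  ext x
  simp only [adrEnd_apply, Module.End.mul_apply, adr, map_mul, key]

lemma adrEnd_one (hSone : Smap 1 = 1) : adrEnd Smap Δmap 1 = 1 := by
  ext x
  simp [adrEnd_apply, adr, Algebra.TensorProduct.one_def, adrBil, hSone]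

lemma adrEnd_pow (hSmul : ∀ u v : Uq, Smap (u * v) = Smap v * Smap u) (hSone : Smap 1 = 1)
    (y : Uq) (n : ℕ) : adrEnd Smap Δmap (y ^ n) = adrEnd Smap Δmap y ^ n := by
  induction n with
  | zero => rw [pow_zero, pow_zero, adrEnd_one Δmap hSone]
  | succ n ih => rw [pow_succ, adrEnd_mul Δmap hSmul, ih, pow_succ']

end AdjointAction

/-- For every `m ≥ 1`: `ad^r(K)((EK⁻¹)^m) = q^{-2m}(EK⁻¹)^m`, `ad^r(E)((EK⁻¹)^m) = 0`,
`ad^r(F^k)((EK⁻¹)^m) ≠ 0` for `0 ≤ k ≤ 2m`, `ad^r(F^k)((EK⁻¹)^m) = 0` for `k ≥ 2m+1`;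
consequently the `ℂ(q)`-span of `ad^r(U_q)((EK⁻¹)^m)` has dimension `2m + 1`. -/
theorem statement5
    (Δmap : Uq →ₐ[Kq] Uq ⊗[Kq] Uq)
    (hΔE : Δmap Eel = Eel ⊗ₜ[Kq] Kel + 1 ⊗ₜ[Kq] Eel)
    (hΔF : Δmap Fel = Kinvel ⊗ₜ[Kq] Fel + Fel ⊗ₜ[Kq] 1)
    (hΔK : Δmap Kel = Kel ⊗ₜ[Kq] Kel)
    (hΔKinv : Δmap Kinvel = Kinvel ⊗ₜ[Kq] Kinvel)
    (Smap : Uq →ₗ[Kq] Uq)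
    (hSmul : ∀ u v : Uq, Smap (u * v) = Smap v * Smap u)
    (hSone : Smap 1 = 1)
    (hSE : Smap Eel = -(Eel * Kinvel))
    (hSF : Smap Fel = -(Kel * Fel))
    (hSK : Smap Kel = Kinvel)
    (hSKinv : Smap Kinvel = Kel)
    (m : ℕ) (hm : 1 ≤ m) :
    adr Smap Δmap Kel ((Eel * Kinvel) ^ m) = (qv⁻¹ ^ (2 * m)) • (Eel * Kinvel) ^ m
    ∧ adr Smap Δmap Eel ((Eel * Kinvel) ^ m) = 0
    ∧ (∀ k : ℕ, k ≤ 2 * m → adr Smap Δmap (Fel ^ k) ((Eel * Kinvel) ^ m) ≠ 0)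
    ∧ (∀ k : ℕ, 2 * m + 1 ≤ k → adr Smap Δmap (Fel ^ k) ((Eel * Kinvel) ^ m) = 0)
    ∧ Module.finrank Kq
        ↥(Submodule.span Kq (Set.range fun y : Uq => adr Smap Δmap y ((Eel * Kinvel) ^ m)))
        = 2 * m + 1 := by
  have hadr (y x : Uq) : adr Smap Δmap y x = adrEnd Smap Δmap y x := rfl
  have hAmul (y z : Uq) := adrEnd_mul Δmap hSmul y z
  have hq := qv_ne_zero
  have hs := sub_inv_ne_zero_of_generic hq qv_zpow_eq_one
  have hK (x : Uq) : adrEnd Smap Δmap Kel x = Kinvel * x * Kel := by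
    simp [adrEnd_apply, adr, hΔK, adrBil, hSK]
  have hE (x : Uq) : adrEnd Smap Δmap Eel x = -(Eel * Kinvel) * x * Kel + x * Eel := by
    simp [adrEnd_apply, adr, hΔE, adrBil, hSE, hSone]
  have hF : adrEnd Smap Δmap Fel = twistedCommutator Kq Kel Fel := by
    ext x
    rw [← mul_mul_add_neg_mul_eq_twistedCommutator]
    simp [adrEnd_apply, adr, hΔF, adrBil, hSF, hSKinv]
  have hKK' := Kel_mul_Kinvel
  have hK'K := Kinvel_mul_Kel
  have hKx : adrEnd Smap Δmap Kel ((Eel * Kinvel) ^ m)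
      = (qv⁻¹ ^ (2 * m)) • (Eel * Kinvel) ^ m := by
    rw [hK, pow_mul]
    exact conj_pow_of_conj hK'K hKK' (conj_inv_mul_of_conj hq hK'K Kel_mul_Eel_mul_Kinvel) m
  have hEx : adrEnd Smap Δmap Eel ((Eel * Kinvel) ^ m) = 0 := by
    rw [hE]
    exact neg_mul_pow_mul_add_pow_mul hK'K m
  have hKx' : adrEnd Smap Δmap Kel ((Eel * Kinvel) ^ m)
      = qv ^ (-(2 * m : ℤ)) • (Eel * Kinvel) ^ m := by
    rw [hKx, inv_pow, zpow_neg, ← zpow_natCast]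
    push_cast
    rfl
  have hKF (x : Uq) : adrEnd Smap Δmap Kel (adrEnd Smap Δmap Fel x)
      = qv ^ 2 • adrEnd Smap Δmap Fel (adrEnd Smap Δmap Kel x) := by
    rw [← Module.End.mul_apply, ← Module.End.mul_apply, ← hAmul, ← hAmul,
      mul_eq_smul_of_conj hq hK'K Kel_mul_Fel_mul_Kinvel, adrEnd_smul, LinearMap.smul_apply]
  have hKinvK (x : Uq) : adrEnd Smap Δmap Kinvel (adrEnd Smap Δmap Kel x) = x := by
    rw [← Module.End.mul_apply, ← hAmul, hKK', adrEnd_one Δmap hSone, Module.End.one_apply]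
  have hEF (x : Uq) : adrEnd Smap Δmap Eel (adrEnd Smap Δmap Fel x)
      = adrEnd Smap Δmap Fel (adrEnd Smap Δmap Eel x)
        - (qv - qv⁻¹)⁻¹ • (adrEnd Smap Δmap Kel x - adrEnd Smap Δmap Kinvel x) := by
    have h2 := LinearMap.congr_fun (congrArg (adrEnd Smap Δmap)
      (mul_eq_add_smul_add_smul_of_commutator (k := Kq) Eel_mul_Fel_sub)) x
    rw [adrEnd_add, adrEnd_add, adrEnd_smul, adrEnd_smul, hAmul, hAmul] at h2
    simp only [LinearMap.add_apply, LinearMap.smul_apply, Module.End.mul_apply] at h2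
    rw [h2]
    exact add_neg_smul_add_smul _ _ _ _
  have hraise := raising_pow_apply hq hs hKF hKinvK hEF hKx' hEx
  have hweight := weight_pow_apply hq hKF hKx'
  have hne (k : ℕ) (hk : k ≤ 2 * m) := pow_apply_ne_zero_of_highest hq qv_zpow_eq_one
    (Eel_mul_Kinvel_pow_ne_zero m) hraise hk
  have hvan (k : ℕ) (hk : 2 * m + 1 ≤ k) :
      (adrEnd Smap Δmap Fel ^ k) ((Eel * Kinvel) ^ m) = 0 := by
    obtain ⟨j, rfl⟩ := Nat.exists_eq_add_of_le' hk
    rw [pow_add, Module.End.mul_apply, hF, twisted_pow_pow_eq_zero (d := 2)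
      (twistedCommutator_mul hK'K) (twistedCommutator_conj hq hK'K Kel_mul_Fel_mul_Kinvel)
      (twistedCommutator_one _ _)
      (twistedCommutator_pow_three hq hKK' hK'K Kel_mul_Eel_mul_Kinvel Kel_mul_Fel_mul_Kinvel
        Eel_mul_Fel_sub), map_zero]
  refine ⟨hKx, hEx, fun k hk => ?_, fun k hk => ?_, ?_⟩
  · rw [hadr, adrEnd_pow Δmap hSmul hSone]
    exact hne k hk
  · rw [hadr, adrEnd_pow Δmap hSmul hSone]
    exact hvan k hk
  have hli := linearIndependent_pow_apply (N := 2 * m + 1) hq qv_zpow_eq_one hweight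
    fun n hn => hne n (by omega)
  have hspan : Submodule.span Kq (Set.range fun y : Uq => adr Smap Δmap y ((Eel * Kinvel) ^ m))
      = Submodule.span Kq (Set.range fun i : Fin (2 * m + 1) =>
          (adrEnd Smap Δmap Fel ^ (i : ℕ)) ((Eel * Kinvel) ^ m)) := by
    apply le_antisymm
    · set W := Submodule.span Kq (Set.range fun i : Fin (2 * m + 1) =>
          (adrEnd Smap Δmap Fel ^ (i : ℕ)) ((Eel * Kinvel) ^ m)) with hW
      have hmem (n : ℕ) : (adrEnd Smap Δmap Fel ^ n) ((Eel * Kinvel) ^ m) ∈ W := by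
        rcases Nat.lt_or_ge n (2 * m + 1) with hn | hn
        · exact Submodule.subset_span ⟨⟨n, hn⟩, rfl⟩
        · rw [hvan n hn]
          exact W.zero_mem
      have hgen (T : Module.End Kq Uq)
          (h : ∀ n : ℕ, T ((adrEnd Smap Δmap Fel ^ n) ((Eel * Kinvel) ^ m)) ∈ W) :
          W ≤ W.comap T :=
        Submodule.span_le.2 (by rintro _ ⟨i, rfl⟩; exact h i)
      have hstable (y : Uq) : W ≤ W.comap (adrEnd Smap Δmap y) := by
        induction y using Uq_induction with
        | hE =>
          refine hgen _ fun n => ?_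
          rcases n with _ | n
          · rw [pow_zero, Module.End.one_apply, hEx]
            exact W.zero_mem
          · rw [hraise]
            exact W.smul_mem _ (hmem n)
        | hF =>
          refine hgen _ fun n => ?_
          rw [← Module.End.mul_apply, ← pow_succ']
          exact hmem (n + 1)
        | hK =>
          refine hgen _ fun n => ?_
          rw [hweight]
          exact W.smul_mem _ (hmem n)
        | hK' =>
          refine hgen _ fun n => ?_
          have h := hKinvK ((adrEnd Smap Δmap Fel ^ n) ((Eel * Kinvel) ^ m))
          rw [hweight, map_smul] at h
          exact (W.smul_mem_iff (zpow_ne_zero _ hq)).1 (h ▸ hmem n)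
        | halg c =>
          intro w hw
          rw [Submodule.mem_comap, Algebra.algebraMap_eq_smul_one, adrEnd_smul,
            adrEnd_one Δmap hSone]
          exact W.smul_mem c hw
        | hadd u v hu hv =>
          intro w hw
          rw [Submodule.mem_comap, adrEnd_add]
          exact W.add_mem (hu hw) (hv hw)
        | hmul u v hu hv =>
          intro w hw
          rw [Submodule.mem_comap, hAmul]
          exact hv (hu hw)
      refine Submodule.span_le.2 ?_
      rintro _ ⟨y, rfl⟩
      exact hstable y (hmem 0)
    · refine Submodule.span_mono ?_
      rintro _ ⟨i, rfl⟩
      exact ⟨Fel ^ (i : ℕ), by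
        change adrEnd Smap Δmap (Fel ^ (i : ℕ)) _ = _
        rw [adrEnd_pow Δmap hSmul hSone]⟩
  rw [hspan, finrank_span_eq_card hli, Fintype.card_fin]
end
end

section
/- In 𝒜_ε the elements b^l, c^l and d^l are central, and the identity d^l T_l(ω) = 1 + d^{2l} + b^l c^l holds. -/
noncomputable section

/-- Generators `a`, `b`, `c`, `d` of the algebra `𝒜_ε = ℒ^ε_{0,1}(sl(2))`. -/
inductive AGen : Type
  | a | b | c | d

/-- The defining relations of `𝒜_ε = ℒ^ε_{0,1}(sl(2))`, the specialization at `q = ε`. -/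
inductive AeRel (ε : ℂ) : FreeAlgebra ℂ AGen → FreeAlgebra ℂ AGen → Prop
  | ad_comm : AeRel ε (FreeAlgebra.ι ℂ AGen.a * FreeAlgebra.ι ℂ AGen.d)
      (FreeAlgebra.ι ℂ AGen.d * FreeAlgebra.ι ℂ AGen.a)
  | db : AeRel ε (FreeAlgebra.ι ℂ AGen.d * FreeAlgebra.ι ℂ AGen.b)
      ((ε ^ 2) • (FreeAlgebra.ι ℂ AGen.b * FreeAlgebra.ι ℂ AGen.d))
  | cd : AeRel ε (FreeAlgebra.ι ℂ AGen.c * FreeAlgebra.ι ℂ AGen.d)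
      ((ε ^ 2) • (FreeAlgebra.ι ℂ AGen.d * FreeAlgebra.ι ℂ AGen.c))
  | ab : AeRel ε (FreeAlgebra.ι ℂ AGen.a * FreeAlgebra.ι ℂ AGen.b
        - FreeAlgebra.ι ℂ AGen.b * FreeAlgebra.ι ℂ AGen.a)
      ((-(1 - ε⁻¹ ^ 2)) • (FreeAlgebra.ι ℂ AGen.b * FreeAlgebra.ι ℂ AGen.d))
  | cb : AeRel ε (FreeAlgebra.ι ℂ AGen.c * FreeAlgebra.ι ℂ AGen.b
        - FreeAlgebra.ι ℂ AGen.b * FreeAlgebra.ι ℂ AGen.c)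
      ((1 - ε⁻¹ ^ 2) • (FreeAlgebra.ι ℂ AGen.d * FreeAlgebra.ι ℂ AGen.a
        - FreeAlgebra.ι ℂ AGen.d * FreeAlgebra.ι ℂ AGen.d))
  | ac : AeRel ε (FreeAlgebra.ι ℂ AGen.a * FreeAlgebra.ι ℂ AGen.c
        - FreeAlgebra.ι ℂ AGen.c * FreeAlgebra.ι ℂ AGen.a)
      ((1 - ε⁻¹ ^ 2) • (FreeAlgebra.ι ℂ AGen.d * FreeAlgebra.ι ℂ AGen.c))
  | det : AeRel ε (FreeAlgebra.ι ℂ AGen.a * FreeAlgebra.ι ℂ AGen.d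
        - (ε ^ 2) • (FreeAlgebra.ι ℂ AGen.b * FreeAlgebra.ι ℂ AGen.c)) 1

/-- The algebra `𝒜_ε = ℒ^ε_{0,1}(sl(2))`, presented by generators and relations. -/
abbrev Ae (ε : ℂ) : Type := RingQuot (AeRel ε)

noncomputable def aE (ε : ℂ) : Ae ε := RingQuot.mkAlgHom ℂ (AeRel ε) (FreeAlgebra.ι ℂ AGen.a)
noncomputable def bE (ε : ℂ) : Ae ε := RingQuot.mkAlgHom ℂ (AeRel ε) (FreeAlgebra.ι ℂ AGen.b)
noncomputable def cE (ε : ℂ) : Ae ε := RingQuot.mkAlgHom ℂ (AeRel ε) (FreeAlgebra.ι ℂ AGen.c)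
noncomputable def dE (ε : ℂ) : Ae ε := RingQuot.mkAlgHom ℂ (AeRel ε) (FreeAlgebra.ι ℂ AGen.d)

/-- The element `ω = ε a + ε⁻¹ d`. -/
noncomputable def ωE (ε : ℂ) : Ae ε := ε • aE ε + ε⁻¹ • dE ε

/-- The normalized Chebyshev polynomials: `T 0 = 2`, `T 1 = X`,
`T (k+2) = X * T (k+1) - T k`. -/
noncomputable def Tpol : ℕ → Polynomial ℂ
  | 0 => 2
  | 1 => Polynomial.X
  | k + 2 => Polynomial.X * Tpol (k + 1) - Tpol k

namespace Ae

/-- `T_k(α + α⁻¹) = α^k + α^{-k}`. -/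
theorem eval_Tpol_add_inv {α : ℂ} (hα : α ≠ 0) :
    ∀ k, (Tpol k).eval (α + α⁻¹) = α ^ k + α⁻¹ ^ k
  | 0 => by simp [Tpol]; norm_num
  | 1 => by simp [Tpol]
  | k + 2 => by
    have h : α * α⁻¹ = 1 := mul_inv_cancel₀ hα
    rw [Tpol, Polynomial.eval_sub, Polynomial.eval_mul, Polynomial.eval_X,
      eval_Tpol_add_inv hα (k + 1), eval_Tpol_add_inv hα k]
    linear_combination (α ^ k + α⁻¹ ^ k) * h

theorem prod_one_sub_odd_pow_mul {l : ℕ} (hodd : Odd l) {η : ℂ} (hη : IsPrimitiveRoot η l)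
    (y : ℂ) : ∏ k ∈ Finset.range l, (1 - η ^ (2 * k + 1) * y) = 1 - y ^ l := by
  have hμ : IsPrimitiveRoot (η ^ 2) l :=
    hη.pow_of_coprime 2 (Nat.coprime_two_left.mpr hodd)
  have h := congrArg (Polynomial.eval 1)
    (X_pow_sub_C_eq_prod hμ hodd.pos (α := η * y) (a := (η * y) ^ l) rfl)
  simp only [Polynomial.eval_sub, Polynomial.eval_pow, Polynomial.eval_X, Polynomial.eval_C,
    Polynomial.eval_prod, one_pow, mul_pow, hη.pow_eq_one, one_mul] at h
  rw [h]
  refine Finset.prod_congr rfl fun k _ => ?_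
  ring

theorem prod_quadratic_complex {l : ℕ} (hodd : Odd l) {η : ℂ} (hη : IsPrimitiveRoot η l)
    (w x : ℂ) :
    ∏ k ∈ Finset.range l, (1 - w * (η ^ (2 * k + 1) * x) + (η ^ (2 * k + 1) * x) ^ 2)
      = 1 - (Tpol l).eval w * x ^ l + x ^ (2 * l) := by
  obtain ⟨α, hα⟩ : ∃ α : ℂ, α * α - w * α + 1 = 0 := by
    obtain ⟨s, hs⟩ := IsAlgClosed.exists_pow_nat_eq (w ^ 2 - 4) two_pos
    exact ⟨(w + s) / 2, by linear_combination hs / 4⟩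
  have hα0 : α ≠ 0 := by
    rintro rfl
    simp at hα
  have hinv : α * α⁻¹ = 1 := mul_inv_cancel₀ hα0
  have hw : w = α + α⁻¹ := by
    linear_combination -α⁻¹ * hα - (w - α) * hinv
  subst hw
  rw [eval_Tpol_add_inv hα0]
  calc _ = ∏ k ∈ Finset.range l,
        ((1 - η ^ (2 * k + 1) * (α * x)) * (1 - η ^ (2 * k + 1) * (α⁻¹ * x))) := by
        refine Finset.prod_congr rfl fun k _ => ?_
        linear_combination -(η ^ (2 * k + 1) * x) ^ 2 * hinv
    _ = (1 - (α * x) ^ l) * (1 - (α⁻¹ * x) ^ l) := by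
        rw [Finset.prod_mul_distrib, prod_one_sub_odd_pow_mul hodd hη,
          prod_one_sub_odd_pow_mul hodd hη]
    _ = _ := by
        have h : α ^ l * α⁻¹ ^ l = 1 := by rw [← mul_pow, hinv, one_pow]
        rw [mul_pow, mul_pow, pow_mul']
        linear_combination (x ^ l) ^ 2 * h

/-- `∏_{k<l} (1 - w η^{2k+1} x + η^{4k+2} x²) = 1 - T_l(w) x^l + x^{2l}` in any commutative
`ℂ`-algebra, for `η` a primitive `l`-th root of unity with `l` odd. -/
theorem prod_quadratic {R : Type*} [CommRing R] [Algebra ℂ R] {l : ℕ} (hodd : Odd l) {η : ℂ}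
    (hη : IsPrimitiveRoot η l) (w x : R) :
    ∏ k ∈ Finset.range l, (1 - w * (η ^ (2 * k + 1) • x) + (η ^ (2 * k + 1) • x) ^ 2)
      = 1 - Polynomial.aeval w (Tpol l) * x ^ l + x ^ (2 * l) := by
  have key : ∏ k ∈ Finset.range l, (1 - (MvPolynomial.X 0 : MvPolynomial (Fin 2) ℂ) *
        (η ^ (2 * k + 1) • MvPolynomial.X 1) + (η ^ (2 * k + 1) • MvPolynomial.X 1) ^ 2)
      = 1 - Polynomial.aeval (MvPolynomial.X 0) (Tpol l) * MvPolynomial.X 1 ^ l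
        + MvPolynomial.X 1 ^ (2 * l) := by
    refine MvPolynomial.funext fun s => ?_
    have hT : MvPolynomial.eval s
        (Polynomial.aeval (MvPolynomial.X 0 : MvPolynomial (Fin 2) ℂ) (Tpol l))
          = (Tpol l).eval (s 0) := by
      have := Polynomial.aeval_algHom_apply
        (MvPolynomial.aeval s : MvPolynomial (Fin 2) ℂ →ₐ[ℂ] ℂ) (MvPolynomial.X 0) (Tpol l)
      simpa [MvPolynomial.coe_aeval_eq_eval, Polynomial.coe_aeval_eq_eval] using this.symm
    simpa [hT, MvPolynomial.smul_eval, -Algebra.mul_smul_comm] using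
      prod_quadratic_complex hodd hη (s 0) (s 1)
  have := congrArg (MvPolynomial.aeval ![w, x] : MvPolynomial (Fin 2) ℂ →ₐ[ℂ] R) key
  simpa [map_prod, ← Polynomial.aeval_algHom_apply] using this

open scoped IsMulCommutative in
/-- Two commuting elements lie in the image of a commutative algebra. -/
theorem exists_algHom_of_commute.{u} {A : Type u} [Ring A] [Algebra ℂ A] {w x : A}
    (h : Commute w x) : ∃ (R : Type u) (_ : CommRing R) (_ : Algebra ℂ R) (φ : R →ₐ[ℂ] A)
      (w' x' : R), φ w' = w ∧ φ x' = x := by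
  have hcomm : ∀ y ∈ ({w, x} : Set A), ∀ z ∈ ({w, x} : Set A), y * z = z * y := by
    rintro y (rfl | rfl) z (rfl | rfl)
    exacts [rfl, h, h.symm, rfl]
  have := Algebra.isMulCommutative_adjoin ℂ hcomm
  exact ⟨Algebra.adjoin ℂ {w, x}, inferInstance, inferInstance,
    (Algebra.adjoin ℂ {w, x}).val, ⟨w, Algebra.subset_adjoin (by simp)⟩,
    ⟨x, Algebra.subset_adjoin (by simp)⟩, rfl, rfl⟩

variable (ε : ℂ)

theorem aE_mul_dE : aE ε * dE ε = dE ε * aE ε := by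
  simpa [aE, dE] using RingQuot.mkAlgHom_rel ℂ (AeRel.ad_comm (ε := ε))

theorem dE_mul_bE : dE ε * bE ε = ε ^ 2 • (bE ε * dE ε) := by
  simpa [bE, dE] using RingQuot.mkAlgHom_rel ℂ (AeRel.db (ε := ε))

theorem cE_mul_dE : cE ε * dE ε = ε ^ 2 • (dE ε * cE ε) := by
  simpa [cE, dE] using RingQuot.mkAlgHom_rel ℂ (AeRel.cd (ε := ε))

theorem aE_mul_bE : aE ε * bE ε - bE ε * aE ε = (-(1 - ε⁻¹ ^ 2)) • (bE ε * dE ε) := by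
  simpa only [aE, bE, dE, map_sub, map_mul, map_smul] using
    RingQuot.mkAlgHom_rel ℂ (AeRel.ab (ε := ε))

theorem cE_mul_bE : cE ε * bE ε - bE ε * cE ε
    = (1 - ε⁻¹ ^ 2) • (dE ε * aE ε - dE ε * dE ε) := by
  simpa only [aE, bE, cE, dE, map_sub, map_mul, map_smul] using
    RingQuot.mkAlgHom_rel ℂ (AeRel.cb (ε := ε))

theorem aE_mul_cE : aE ε * cE ε - cE ε * aE ε = (1 - ε⁻¹ ^ 2) • (dE ε * cE ε) := by
  simpa only [aE, cE, dE, map_sub, map_mul, map_smul] using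
    RingQuot.mkAlgHom_rel ℂ (AeRel.ac (ε := ε))

theorem aE_mul_dE_sub : aE ε * dE ε - ε ^ 2 • (bE ε * cE ε) = 1 := by
  simpa only [aE, bE, cE, dE, map_sub, map_mul, map_smul, map_one] using
    RingQuot.mkAlgHom_rel ℂ (AeRel.det (ε := ε))

variable {ε}

/-- An element commuting with the four generators is central. -/
theorem mem_center_of_commute {z : Ae ε} (ha : Commute (aE ε) z) (hb : Commute (bE ε) z)
    (hc : Commute (cE ε) z) (hd : Commute (dE ε) z) : z ∈ Subalgebra.center ℂ (Ae ε) := by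
  rw [Subalgebra.mem_center_iff]
  intro y
  obtain ⟨y, rfl⟩ := RingQuot.mkAlgHom_surjective ℂ (AeRel ε) y
  change Commute _ _
  induction y using FreeAlgebra.induction with
  | grade0 r => rw [AlgHom.commutes]; exact Algebra.commutes r z
  | grade1 x => cases x <;> assumption
  | mul x y hx hy => rw [map_mul]; exact hx.mul_left hy
  | add x y hx hy => rw [map_add]; exact hx.add_left hy

theorem aE_eq (hε : ε ≠ 0) : aE ε = ε⁻¹ • ωE ε - ε⁻¹ ^ 2 • dE ε := by
  rw [ωE]
  match_scalars <;> field_simp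
  ring

theorem ωE_mem_center (hε : ε ≠ 0) : ωE ε ∈ Subalgebra.center ℂ (Ae ε) := by
  have hd : Commute (dE ε) (ωE ε) := by
    rw [commute_iff_eq, ωE, mul_add, add_mul, mul_smul_comm, smul_mul_assoc, aE_mul_dE,
      mul_smul_comm, smul_mul_assoc]
  have hb : Commute (bE ε) (ωE ε) := by
    rw [commute_iff_eq, ωE, mul_add, add_mul, mul_smul_comm, smul_mul_assoc,
      mul_smul_comm, smul_mul_assoc, dE_mul_bE, eq_add_of_sub_eq (aE_mul_bE ε)]
    match_scalars <;> field_simp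
    ring
  have hc : Commute (cE ε) (ωE ε) := by
    rw [commute_iff_eq, ωE, mul_add, add_mul, mul_smul_comm, smul_mul_assoc,
      mul_smul_comm, smul_mul_assoc, cE_mul_dE, eq_add_of_sub_eq (aE_mul_cE ε)]
    match_scalars <;> field_simp
    ring
  refine mem_center_of_commute ?_ hb hc hd
  rw [ωE]
  exact ((Commute.refl _).smul_right _).add_right (Commute.smul_right (aE_mul_dE ε) _)

theorem ωE_commute (hε : ε ≠ 0) (y : Ae ε) : Commute (ωE ε) y :=
  (Subalgebra.mem_center_iff.mp (ωE_mem_center hε) y).symm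

/-- The polynomial `1 - ω y + y²`. -/
def quadω (ε : ℂ) (y : Ae ε) : Ae ε := 1 - ωE ε * y + y ^ 2

theorem bE_mul_cE_eq (hε : ε ≠ 0) :
    bE ε * cE ε = (-ε⁻¹ ^ 2) • quadω ε (ε⁻¹ • dE ε) := by
  have h : bE ε * cE ε = ε⁻¹ ^ 2 • (aE ε * dE ε - 1) := by
    rw [← aE_mul_dE_sub ε, sub_sub_cancel, smul_smul, ← mul_pow, inv_mul_cancel₀ hε,
      one_pow, one_smul]
  rw [h, aE_eq hε, quadω, sub_mul, smul_mul_assoc, smul_mul_assoc, mul_smul_comm, smul_pow,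
    ← pow_two]
  match_scalars <;> field_simp

theorem cE_mul_bE_eq (hε : ε ≠ 0) :
    cE ε * bE ε = (-ε⁻¹ ^ 2) • quadω ε (ε • dE ε) := by
  rw [eq_add_of_sub_eq (cE_mul_bE ε), bE_mul_cE_eq hε, ← aE_mul_dE, aE_eq hε, quadω, quadω,
    sub_mul, smul_mul_assoc, smul_mul_assoc, mul_smul_comm, smul_pow, mul_smul_comm, smul_pow,
    ← pow_two]
  match_scalars <;> field_simp <;> ring

theorem mul_quadω (hε : ε ≠ 0) {u y z : Ae ε} (h : u * y = z * u) :
    u * quadω ε y = quadω ε z * u := by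
  rw [quadω, quadω, mul_add, mul_sub, add_mul, sub_mul, ← mul_assoc u,
    ← (ωE_commute hε u).eq, mul_assoc, h, pow_two, pow_two, ← mul_assoc u, h, mul_assoc z, h,
    mul_one, one_mul, mul_assoc, mul_assoc]

theorem bE_pow_mul_dE (hε : ε ≠ 0) (n : ℕ) :
    bE ε ^ n * dE ε = (ε⁻¹ ^ (2 * n) • dE ε) * bE ε ^ n := by
  induction n with
  | zero => simp
  | succ n ih =>
    have h : bE ε * dE ε = ε⁻¹ ^ 2 • (dE ε * bE ε) := by
      rw [dE_mul_bE, smul_smul, ← mul_pow, inv_mul_cancel₀ hε, one_pow, one_smul]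
    rw [pow_succ, mul_assoc, h, mul_smul_comm, ← mul_assoc, ih, smul_mul_assoc, smul_mul_assoc,
      smul_mul_assoc, smul_smul, mul_assoc, ← pow_succ, ← pow_add]
    congr 2
    ring

theorem cE_pow_mul_dE (n : ℕ) :
    cE ε ^ n * dE ε = (ε ^ (2 * n) • dE ε) * cE ε ^ n := by
  induction n with
  | zero => simp
  | succ n ih =>
    rw [pow_succ, mul_assoc, cE_mul_dE, mul_smul_comm, ← mul_assoc, ih, smul_mul_assoc,
      smul_mul_assoc, smul_mul_assoc, smul_smul, mul_assoc, ← pow_succ, ← pow_add]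
    congr 2
    ring

theorem bE_pow_mul_smul_dE (hε : ε ≠ 0) (n : ℕ) (r : ℂ) :
    bE ε ^ n * (r • dE ε) = ((ε⁻¹ ^ (2 * n) * r) • dE ε) * bE ε ^ n := by
  rw [mul_smul_comm, bE_pow_mul_dE hε, ← smul_mul_assoc, smul_smul, mul_comm]

theorem cE_pow_mul_smul_dE (n : ℕ) (r : ℂ) :
    cE ε ^ n * (r • dE ε) = ((ε ^ (2 * n) * r) • dE ε) * cE ε ^ n := by
  rw [mul_smul_comm, cE_pow_mul_dE, ← smul_mul_assoc, smul_smul, mul_comm]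

theorem commute_aE (hε : ε ≠ 0) {y : Ae ε} (h : Commute (dE ε) y) : Commute (aE ε) y := by
  rw [aE_eq hε]
  exact ((ωE_commute hε y).smul_left _).sub_left (h.smul_left _)

section RootOfUnity

variable {l : ℕ}

theorem commute_dE_bE_pow (hε : ε ≠ 0) (h1 : ε ^ l = 1) : Commute (dE ε) (bE ε ^ l) := by
  rw [commute_iff_eq, bE_pow_mul_dE hε, mul_comm 2, pow_mul, inv_pow, h1]
  simp

theorem commute_dE_cE_pow (h1 : ε ^ l = 1) : Commute (dE ε) (cE ε ^ l) := by
  rw [commute_iff_eq, cE_pow_mul_dE, mul_comm 2, pow_mul, h1]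
  simp

theorem bE_pow_mem_center (hε : ε ≠ 0) (hl : l ≠ 0) (h1 : ε ^ l = 1) :
    bE ε ^ l ∈ Subalgebra.center ℂ (Ae ε) := by
  have hd : Commute (dE ε) (bE ε ^ l) := commute_dE_bE_pow hε h1
  refine mem_center_of_commute (commute_aE hε hd) (Commute.self_pow _ _) ?_ hd
  obtain ⟨n, rfl⟩ := Nat.exists_eq_succ_of_ne_zero hl
  have hr : ε⁻¹ ^ (2 * n) * ε⁻¹ = ε := by
    have h2 : ε⁻¹ ^ (n + 1) = 1 := by rw [inv_pow, h1, inv_one]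
    have h3 : ε⁻¹ * ε = 1 := inv_mul_cancel₀ hε
    calc ε⁻¹ ^ (2 * n) * ε⁻¹ = (ε⁻¹ ^ (n + 1)) ^ 2 * ε := by
          linear_combination -ε⁻¹ ^ (2 * n) * ε⁻¹ * h3
      _ = ε := by rw [h2]; ring
  rw [commute_iff_eq]
  nth_rewrite 1 [pow_succ' (bE ε)]
  rw [← mul_assoc, cE_mul_bE_eq hε, pow_succ (bE ε), mul_assoc, bE_mul_cE_eq hε,
    mul_smul_comm, mul_quadω hε (bE_pow_mul_smul_dE hε n _), hr, smul_mul_assoc]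

theorem cE_pow_mem_center (hε : ε ≠ 0) (hl : l ≠ 0) (h1 : ε ^ l = 1) :
    cE ε ^ l ∈ Subalgebra.center ℂ (Ae ε) := by
  have hd : Commute (dE ε) (cE ε ^ l) := commute_dE_cE_pow h1
  refine mem_center_of_commute (commute_aE hε hd) ?_ (Commute.self_pow _ _) hd
  obtain ⟨n, rfl⟩ := Nat.exists_eq_succ_of_ne_zero hl
  have hr : ε ^ (2 * n) * ε = ε⁻¹ := by
    calc ε ^ (2 * n) * ε = (ε ^ (n + 1)) ^ 2 * ε⁻¹ := by field_simp; ring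
      _ = ε⁻¹ := by rw [h1]; ring
  rw [commute_iff_eq]
  nth_rewrite 1 [pow_succ' (cE ε)]
  rw [← mul_assoc, bE_mul_cE_eq hε, pow_succ (cE ε), mul_assoc, cE_mul_bE_eq hε,
    mul_smul_comm, mul_quadω hε (cE_pow_mul_smul_dE n _), hr, smul_mul_assoc]

theorem dE_pow_mul_bE (n : ℕ) : dE ε ^ n * bE ε = ε ^ (2 * n) • (bE ε * dE ε ^ n) := by
  induction n with
  | zero => simp
  | succ n ih =>
    rw [pow_succ, mul_assoc, dE_mul_bE, mul_smul_comm, ← mul_assoc, ih, smul_mul_assoc, smul_smul,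
      mul_assoc, ← pow_add]
    congr 2
    ring

theorem cE_mul_dE_pow (n : ℕ) : cE ε * dE ε ^ n = ε ^ (2 * n) • (dE ε ^ n * cE ε) := by
  induction n with
  | zero => simp
  | succ n ih =>
    rw [pow_succ, ← mul_assoc, ih, smul_mul_assoc, mul_assoc, cE_mul_dE, mul_smul_comm, smul_smul,
      ← mul_assoc, ← pow_add]
    congr 2

theorem dE_pow_mem_center (hε : ε ≠ 0) (h1 : ε ^ l = 1) :
    dE ε ^ l ∈ Subalgebra.center ℂ (Ae ε) := by
  have hd : Commute (dE ε) (dE ε ^ l) := Commute.self_pow _ _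
  have h2 : ε ^ (2 * l) = 1 := by rw [mul_comm, pow_mul, h1, one_pow]
  refine mem_center_of_commute (commute_aE hε hd) ?_ ?_ hd
  · rw [commute_iff_eq, dE_pow_mul_bE, h2, one_smul]
  · rw [commute_iff_eq, cE_mul_dE_pow, h2, one_smul]

end RootOfUnity

/-- `b^n c^n` is a product of values of `1 - ω y + y²` at multiples of `d`. -/
theorem bE_pow_mul_cE_pow (hε : ε ≠ 0) {R : Type*} [CommRing R] [Algebra ℂ R]
    (φ : R →ₐ[ℂ] Ae ε) {w x : R} (hw : φ w = ωE ε) (hx : φ x = dE ε) (n : ℕ) :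
    bE ε ^ n * cE ε ^ n = (-ε⁻¹ ^ 2) ^ n • φ (∏ k ∈ Finset.range n,
      (1 - w * (ε⁻¹ ^ (2 * k + 1) • x) + (ε⁻¹ ^ (2 * k + 1) • x) ^ 2)) := by
  induction n with
  | zero => simp
  | succ n ih =>
    have hq : φ (1 - w * (ε⁻¹ ^ (2 * n + 1) • x) + (ε⁻¹ ^ (2 * n + 1) • x) ^ 2)
        = quadω ε (ε⁻¹ ^ (2 * n + 1) • dE ε) := by
      rw [map_add, map_sub, map_mul, map_one, map_pow, map_smul, hw, hx, quadω]
    rw [Finset.prod_range_succ, mul_comm (Finset.prod _ _), map_mul, hq, pow_succ (bE ε),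
      pow_succ' (cE ε), mul_assoc, ← mul_assoc (bE ε), bE_mul_cE_eq hε, smul_mul_assoc,
      mul_smul_comm, ← mul_assoc, mul_quadω hε (bE_pow_mul_smul_dE hε n _), mul_assoc, ih,
      ← pow_succ, mul_smul_comm, smul_smul, ← pow_succ']

theorem bE_pow_mul_cE_pow_eq {l : ℕ} (hodd : Odd l) (hε : IsPrimitiveRoot ε l) :
    bE ε ^ l * cE ε ^ l
      = -(1 - Polynomial.aeval (ωE ε) (Tpol l) * dE ε ^ l + dE ε ^ (2 * l)) := by
  have h0 : ε ≠ 0 := hε.ne_zero hodd.pos.ne'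
  have hs : (-ε⁻¹ ^ 2) ^ l = -1 := by
    rw [hodd.neg_pow, ← pow_mul, mul_comm, pow_mul, inv_pow, hε.pow_eq_one]
    simp
  obtain ⟨R, _, _, φ, w, x, hw, hx⟩ := exists_algHom_of_commute (ωE_commute h0 (dE ε))
  rw [bE_pow_mul_cE_pow h0 φ hw hx, prod_quadratic hodd hε.inv, hs]
  refine (neg_one_smul ℂ (M := Ae ε) _).trans ?_
  rw [map_add, map_sub, map_mul, ← Polynomial.aeval_algHom_apply, map_one, map_pow, map_pow,
    hw, hx]

end Ae

/-- Let `l ≥ 3` be odd and `ε` a primitive `l`-th root of unity.  In `𝒜_ε` the elements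
`b^l`, `c^l`, `d^l` are central, and `d^l T_l(ω) = 1 + d^{2l} + b^l c^l`. -/
theorem statement10 (l : ℕ) (hl : 3 ≤ l) (hodd : Odd l)
    (ε : ℂ) (hε : IsPrimitiveRoot ε l) :
    bE ε ^ l ∈ Subalgebra.center ℂ (Ae ε)
    ∧ cE ε ^ l ∈ Subalgebra.center ℂ (Ae ε)
    ∧ dE ε ^ l ∈ Subalgebra.center ℂ (Ae ε)
    ∧ dE ε ^ l * Polynomial.aeval (ωE ε) (Tpol l)
      = 1 + dE ε ^ (2 * l) + bE ε ^ l * cE ε ^ l := by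
  have h0 : ε ≠ 0 := hε.ne_zero hodd.pos.ne'
  have hd := Ae.dE_pow_mem_center h0 hε.pow_eq_one
  refine ⟨Ae.bE_pow_mem_center h0 hodd.pos.ne' hε.pow_eq_one,
    Ae.cE_pow_mem_center h0 hodd.pos.ne' hε.pow_eq_one, hd, ?_⟩
  rw [Ae.bE_pow_mul_cE_pow_eq hodd hε, Subalgebra.mem_center_iff.mp hd]
  abel
end
end
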